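/- Let H, N, K ≥ 1 be integers, α ∈ [0,1], λ > 0, and H_α := Σ_{t=0}^{H−1} α^{2t}. For each k ∈ {1,…,K} let σ_k : {1,…,H} → {1,…,N} be injective and let d_t^k := H_α^{−1/2} Σ_{m=1}^{t} α^{t−m} e_{σ_k(m)} for t ∈ {1,…,H}, where e_j is the j-th standard basis vector of ℝ^N. Let V = λ I_N + Σ_{k=1}^{K} Σ_{t=1}^{H} d_t^k (d_t^k)ᵀ. Fix j ∈ {1,…,N} and h ∈ {1,…,H}, and let n = |{k ∈ {1,…,K} : σ_k(h) = j}|. If n ≥ 1, then e_jᵀ V^{−1} e_j ≤ 4 H_α / ( n + 4 λ H_α ). -/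

import Mathlib

open Finset Matrix Classical

attribute [local instance] Classical.propDecidable

/-- Effective history horizon `H_α = ∑_{t=0}^{H-1} α^{2t}`. -/
noncomputable def effHorizon (H : ℕ) (α : ℝ) : ℝ := ∑ t ∈ Finset.range H, α ^ (2 * t)

/-- Discounted visitation vector
`d_t = H_α^{-1/2} ∑_{m ≤ t} α^{t-m} e_{σ(m)} ∈ ℝ^N`. -/
noncomputable def discVisit (H N : ℕ) (α : ℝ) (σ : Fin H → Fin N) (t : Fin H) :
    Fin N → ℝ := fun j =>
  (Real.sqrt (effHorizon H α))⁻¹ *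
    ∑ m ∈ Finset.Iic t, α ^ ((t : ℕ) - (m : ℕ)) * (if σ m = j then 1 else 0)

lemma effHorizon_pos {H : ℕ} (hH : 1 ≤ H) (α : ℝ) : 0 < effHorizon H α := by
  unfold effHorizon
  refine Finset.sum_pos' (fun t _ => ?_) ⟨0, Finset.mem_range.2 hH, by simp⟩
  rw [pow_mul]
  positivity

/-- Unnormalized inner product of `x` with the discounted visitation vector at time `t`. -/
noncomputable def discSum {H N : ℕ} (α : ℝ) (σ : Fin H → Fin N) (x : Fin N → ℝ) (t : Fin H) : ℝ :=
  ∑ m ∈ Finset.Iic t, α ^ ((t : ℕ) - (m : ℕ)) * x (σ m)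

lemma discVisit_dotProduct {H N : ℕ} (α : ℝ) (σ : Fin H → Fin N) (x : Fin N → ℝ) (t : Fin H) :
    discVisit H N α σ t ⬝ᵥ x = (Real.sqrt (effHorizon H α))⁻¹ * discSum α σ x t := by
  simp only [dotProduct, discVisit, discSum, mul_assoc, Finset.sum_mul, ← Finset.mul_sum]
  rw [Finset.sum_comm]
  simp

lemma discVisit_dotProduct_sq {H N : ℕ} (α : ℝ) (σ : Fin H → Fin N)
    (x : Fin N → ℝ) (t : Fin H) :
    effHorizon H α * (discVisit H N α σ t ⬝ᵥ x) ^ 2 = discSum α σ x t ^ 2 := by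
  have hpos := effHorizon_pos (Fin.pos t) α
  rw [discVisit_dotProduct, mul_pow, inv_pow, Real.sq_sqrt hpos.le, mul_inv_cancel_left₀ hpos.ne']

lemma discSum_zero {H N : ℕ} (α : ℝ) (σ : Fin H → Fin N) (x : Fin N → ℝ) (h0 : 0 < H) :
    discSum α σ x ⟨0, h0⟩ = x (σ ⟨0, h0⟩) := by
  have : Finset.Iic (⟨0, h0⟩ : Fin H) = {⟨0, h0⟩} := by
    ext m
    simp [Fin.le_def, Fin.ext_iff]
  simp [discSum, this]

lemma discSum_succ {H N : ℕ} (α : ℝ) (σ : Fin H → Fin N) (x : Fin N → ℝ) {p : ℕ}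
    (hp : p + 1 < H) :
    discSum α σ x ⟨p + 1, hp⟩ =
      x (σ ⟨p + 1, hp⟩) + α * discSum α σ x ⟨p, Nat.lt_of_succ_lt hp⟩ := by
  have hIic : Finset.Iic (⟨p + 1, hp⟩ : Fin H) =
      insert ⟨p + 1, hp⟩ (Finset.Iic ⟨p, Nat.lt_of_succ_lt hp⟩) := by
    ext m
    simp only [Finset.mem_Iic, Finset.mem_insert, Fin.le_def, Fin.ext_iff]
    omega
  rw [discSum, hIic, Finset.sum_insert (by simp [Fin.le_def]), discSum, Finset.mul_sum]
  congr 1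
  · simp
  · refine Finset.sum_congr rfl fun m hm => ?_
    have hm' : (m : ℕ) ≤ p := Fin.le_def.1 (Finset.mem_Iic.1 hm)
    rw [Nat.succ_sub hm', pow_succ]
    ring

/-- Each coordinate visited along a trajectory is controlled by the discounted sums. -/
lemma sq_apply_le_sum_discSum_sq {H N : ℕ} {α : ℝ} (hα : α ∈ Set.Icc (0 : ℝ) 1)
    (σ : Fin H → Fin N) (x : Fin N → ℝ) (h : Fin H) :
    x (σ h) ^ 2 ≤ 4 * ∑ t, discSum α σ x t ^ 2 := by
  obtain ⟨_ | p, hp⟩ := h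
  · have := Finset.single_le_sum (f := fun t => discSum α σ x t ^ 2)
      (fun t _ => sq_nonneg _) (Finset.mem_univ ⟨0, hp⟩)
    rw [← discSum_zero α σ x hp]
    nlinarith [sq_nonneg (discSum α σ x ⟨0, hp⟩)]
  · have hpair := Finset.sum_le_sum_of_subset_of_nonneg (f := fun t => discSum α σ x t ^ 2)
      (Finset.subset_univ {(⟨p + 1, hp⟩ : Fin H), ⟨p, Nat.lt_of_succ_lt hp⟩})
      (fun t _ _ => sq_nonneg _)
    rw [Finset.sum_pair (by simp)] at hpair
    have hx := eq_sub_of_add_eq (discSum_succ α σ x hp).symm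
    rw [hx]
    generalize discSum α σ x ⟨p + 1, hp⟩ = a at *
    generalize discSum α σ x ⟨p, Nat.lt_of_succ_lt hp⟩ = b at *
    have hα2 : α ^ 2 ≤ 1 := pow_le_one₀ hα.1 hα.2
    nlinarith [sq_nonneg (a + α * b), mul_le_mul_of_nonneg_right hα2 (sq_nonneg b),
      sq_nonneg a, sq_nonneg b]

lemma sq_apply_le_sum_discVisit_sq {H N : ℕ} {α : ℝ} (hα : α ∈ Set.Icc (0 : ℝ) 1)
    (σ : Fin H → Fin N) (x : Fin N → ℝ) (h : Fin H) :
    x (σ h) ^ 2 ≤ 4 * effHorizon H α * ∑ t, (discVisit H N α σ t ⬝ᵥ x) ^ 2 := by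
  rw [mul_assoc, Finset.mul_sum]
  simpa only [discVisit_dotProduct_sq] using sq_apply_le_sum_discSum_sq hα σ x h

lemma dotProduct_gram_mulVec {ι κ m : Type*} [Fintype ι] [Fintype κ] [Fintype m] [DecidableEq m]
    (lam : ℝ) (d : ι → κ → m → ℝ) (x : m → ℝ) :
    x ⬝ᵥ ((lam • (1 : Matrix m m ℝ) + ∑ k, ∑ t, vecMulVec (d k t) (d k t)) *ᵥ x) =
      lam * (x ⬝ᵥ x) + ∑ k, ∑ t, (d k t ⬝ᵥ x) ^ 2 := by
  simp only [add_mulVec, sum_mulVec, smul_mulVec, one_mulVec, dotProduct_add, dotProduct_sum,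
    dotProduct_smul, smul_eq_mul, vecMulVec_mulVec, sq]
  simp [dotProduct_comm x]

lemma isUnit_det_gram {ι κ m : Type*} [Fintype ι] [Fintype κ] [Fintype m] [DecidableEq m]
    {lam : ℝ} (hlam : 0 < lam) (d : ι → κ → m → ℝ) :
    IsUnit (lam • (1 : Matrix m m ℝ) + ∑ k, ∑ t, vecMulVec (d k t) (d k t)).det := by
  rw [isUnit_iff_ne_zero]
  intro hdet
  obtain ⟨x, hx, hVx⟩ := exists_mulVec_eq_zero_iff.2 hdet
  have hform := dotProduct_gram_mulVec lam d x
  rw [hVx, dotProduct_zero] at hform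
  have hsum : 0 ≤ ∑ k, ∑ t, (d k t ⬝ᵥ x) ^ 2 := by positivity
  have hxx : 0 ≤ x ⬝ᵥ x := Finset.sum_nonneg fun i _ => mul_self_nonneg (x i)
  exact hx (dotProduct_self_eq_zero.1 (by nlinarith))

/-- **Local design-matrix bound.** For the λ-regularized Gram matrix `V` accumulated over `K`
episodes of discounted visitation vectors, the `(j,j)` entry of `V⁻¹` is bounded in terms of the
number `n` of episodes that visit coordinate `j` at step `h`: `e_jᵀ V⁻¹ e_j ≤ 4H_α/(n+4λH_α)`. -/
theorem local_gram_inverse_bound (H N K : ℕ) (hH : 1 ≤ H) (hN : 1 ≤ N) (hK : 1 ≤ K)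
    (α : ℝ) (hα : α ∈ Set.Icc (0 : ℝ) 1) (lam : ℝ) (hlam : 0 < lam)
    (σ : Fin K → Fin H → Fin N) (hσ : ∀ k, Function.Injective (σ k))
    (V : Matrix (Fin N) (Fin N) ℝ)
    (hV : V = lam • (1 : Matrix (Fin N) (Fin N) ℝ) +
      ∑ k, ∑ t, Matrix.vecMulVec (discVisit H N α (σ k) t) (discVisit H N α (σ k) t))
    (j : Fin N) (h : Fin H)
    (n : ℕ) (hn : n = ({k : Fin K | σ k h = j} : Finset (Fin K)).card) (hn1 : 1 ≤ n) :
    Pi.single j (1 : ℝ) ⬝ᵥ (V⁻¹ *ᵥ Pi.single j (1 : ℝ)) ≤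
      4 * effHorizon H α / (n + 4 * lam * effHorizon H α) := by
  subst hV
  have hHpos := effHorizon_pos hH α
  set V := lam • (1 : Matrix (Fin N) (Fin N) ℝ) +
    ∑ k, ∑ t, vecMulVec (discVisit H N α (σ k) t) (discVisit H N α (σ k) t) with hV
  set x := V⁻¹ *ᵥ Pi.single j (1 : ℝ) with hx
  have hVx : V *ᵥ x = Pi.single j 1 := by
    rw [hx, mulVec_mulVec, mul_nonsing_inv _ (isUnit_det_gram hlam _), one_mulVec]
  have hform : x j = lam * (x ⬝ᵥ x) + ∑ k, ∑ t, (discVisit H N α (σ k) t ⬝ᵥ x) ^ 2 := by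
    rw [← dotProduct_gram_mulVec lam (fun k t => discVisit H N α (σ k) t) x, ← hV, hVx]
    simp
  have hself : x j ^ 2 ≤ x ⬝ᵥ x := by
    rw [sq]
    exact Finset.single_le_sum (f := fun i => x i * x i) (fun i _ => mul_self_nonneg _)
      (Finset.mem_univ j)
  have hvisits : n * x j ^ 2 ≤
      4 * effHorizon H α * ∑ k, ∑ t, (discVisit H N α (σ k) t ⬝ᵥ x) ^ 2 := by
    rw [hn, ← nsmul_eq_mul, Finset.mul_sum]
    refine (Finset.card_nsmul_le_sum _ _ _ fun k hk => ?_).trans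
      (Finset.sum_le_sum_of_subset_of_nonneg (Finset.subset_univ _) fun k _ _ => by positivity)
    rw [← (Finset.mem_filter.1 hk).2]
    exact sq_apply_le_sum_discVisit_sq hα (σ k) x h
  rw [single_one_dotProduct, le_div_iff₀ (by positivity)]
  have hquad : (n + 4 * lam * effHorizon H α) * x j ^ 2 ≤ 4 * effHorizon H α * x j := by
    nlinarith [mul_le_mul_of_nonneg_left hself (by positivity : 0 ≤ 4 * lam * effHorizon H α)]
  rcases le_or_gt (x j) 0 with hneg | hpos
  · exact (mul_nonpos_of_nonpos_of_nonneg hneg (by positivity)).trans (by positivity)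
  · exact le_of_mul_le_mul_right (by linarith) hpos
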